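/- Let n ≥ 2, E a finite set of ordered pairs (i,j) with i ≠ j, weights λ_{ij} ≥ 0, Λ = Σ_{(i,j)∈E} λ_{ij}P_{ij} with P_{ij} = (e_i−e_j)(e_i−e_j)ᵀ, and assume the kernel of Λ is exactly the span of 𝟙. Let Λ⁺ be the Moore–Penrose pseudoinverse and χ₂[Λ] = (1/2)·sup_{(i,j)∈E}(e_i−e_j)ᵀΛ⁺(e_i−e_j). Let β̃ ∈ ℝ and z̃, z*, y, z, y* ∈ ℝⁿ with y* + z* ∈ span(𝟙). Then Σ_{(i,j)∈E} λ_{ij}(‖z̃ − β̃P_{ij}(y+z) − z*‖²_{Λ⁺} − ‖z̃ − z*‖²_{Λ⁺}) ≤ −2β̃·⟨z̃ − z*, π(y+z)⟩ + χ₂[Λ]·β̃²·Σ_{(i,j)∈E} λ_{ij}‖P_{ij}(y+z)‖², where ‖v‖²_{Λ⁺} = vᵀΛ⁺v and π = I − (1/n)𝟙𝟙ᵀ. -/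

import Mathlib

open Matrix BigOperators

noncomputable section

/-- The vector `e_i - e_j` in `ℝⁿ`. -/
def gVec (n : ℕ) (i j : Fin n) : Fin n → ℝ :=
  fun k => (if k = i then (1 : ℝ) else 0) - (if k = j then (1 : ℝ) else 0)

/-- The rank-one gossip matrix `P_{ij} = (e_i-e_j)(e_i-e_j)ᵀ`. -/
def gP (n : ℕ) (i j : Fin n) : Matrix (Fin n) (Fin n) ℝ :=
  Matrix.vecMulVec (gVec n i j) (gVec n i j)

/-- The expected gossip matrix `Λ = Σ_{(i,j)∈E} λ_{ij} P_{ij}`. -/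
def gMat (n : ℕ) (E : Finset (Fin n × Fin n)) (lam : Fin n × Fin n → ℝ) :
    Matrix (Fin n) (Fin n) ℝ :=
  ∑ p ∈ E, lam p • gP n p.1 p.2

/-- `B` is the Moore–Penrose pseudoinverse of `A`. -/
def IsMPInv {n : ℕ} (A B : Matrix (Fin n) (Fin n) ℝ) : Prop :=
  A * B * A = A ∧ B * A * B = B ∧ (A * B)ᵀ = A * B ∧ (B * A)ᵀ = B * A

/-- `χ₂[Λ] = (1/2)·sup_{(i,j)∈E} (e_i-e_j)ᵀ Λ⁺ (e_i-e_j)`, expressed in terms of the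
pseudoinverse `Λp` of `Λ`. -/
def chi2 (n : ℕ) (E : Finset (Fin n × Fin n)) (Λp : Matrix (Fin n) (Fin n) ℝ) : ℝ :=
  (1 / 2) * sSup {r : ℝ | ∃ p ∈ E, r = gVec n p.1 p.2 ⬝ᵥ (Λp *ᵥ gVec n p.1 p.2)}

/-- The centralized gossip matrix `π = I - (1/n) 𝟙𝟙ᵀ`. -/
def piMat (n : ℕ) : Matrix (Fin n) (Fin n) ℝ :=
  1 - ((n : ℝ))⁻¹ • Matrix.vecMulVec (fun _ => 1) (fun _ => 1)

theorem gP_mulVec (n : ℕ) (i j : Fin n) (w : Fin n → ℝ) :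
    gP n i j *ᵥ w = (gVec n i j ⬝ᵥ w) • gVec n i j := by
  rw [gP, vecMulVec_mulVec, op_smul_eq_smul]

theorem gVec_dotProduct_self {n : ℕ} {i j : Fin n} (h : i ≠ j) :
    gVec n i j ⬝ᵥ gVec n i j = 2 := by
  have e : gVec n i j = Pi.single i 1 - Pi.single j 1 := by
    ext k
    simp [gVec, Pi.single_apply]
  rw [e]
  simp [h, h.symm]
  norm_num

theorem gMat_transpose (n : ℕ) (E : Finset (Fin n × Fin n)) (lam : Fin n × Fin n → ℝ) :
    (gMat n E lam)ᵀ = gMat n E lam := by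
  simp [gMat, transpose_sum, gP, transpose_vecMulVec]

theorem gMat_mulVec (n : ℕ) (E : Finset (Fin n × Fin n)) (lam : Fin n × Fin n → ℝ)
    (w : Fin n → ℝ) : gMat n E lam *ᵥ w = ∑ p ∈ E, lam p • (gP n p.1 p.2 *ᵥ w) := by
  simp [gMat, sum_mulVec, smul_mulVec]

/-- A symmetric matrix `Q` killing constants with `A * Q = A`, where the kernel of `A` consists of
constants, is the centering matrix. -/
theorem eq_piMat {n : ℕ} (hn : n ≠ 0) {A Q : Matrix (Fin n) (Fin n) ℝ}
    (hker : ∀ x : Fin n → ℝ, A *ᵥ x = 0 → ∃ c : ℝ, x = fun _ => c)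
    (hQ : Qᵀ = Q) (hAQ : A * Q = A) (hQ1 : Q *ᵥ (fun _ => 1) = 0) : Q = piMat n := by
  refine ext_of_mulVec_single fun i => ?_
  set x : Fin n → ℝ := Pi.single i 1
  obtain ⟨c, hc⟩ := hker (Q *ᵥ x - x) (by rw [mulVec_sub, mulVec_mulVec, hAQ, sub_self])
  have hQx : Q *ᵥ x = x + fun _ => c := by rw [← hc]; abel
  have h0 : (fun _ => 1) ⬝ᵥ (Q *ᵥ x) = 0 := by
    rw [dotProduct_mulVec, ← mulVec_transpose, hQ, hQ1, zero_dotProduct]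
  have hn' : (n : ℝ) ≠ 0 := Nat.cast_ne_zero.mpr hn
  have hc' : c = -(n : ℝ)⁻¹ := by
    rw [hQx, dotProduct_add] at h0
    simp [x, dotProduct] at h0
    field_simp
    linarith
  rw [hQx, piMat, sub_mulVec, one_mulVec, smul_mulVec, vecMulVec_mulVec, hc']
  ext k
  simp [x, dotProduct, sub_eq_add_neg]

theorem IsMPInv.mul_eq_piMat {n : ℕ} (hn : n ≠ 0) {A B : Matrix (Fin n) (Fin n) ℝ}
    (hmp : IsMPInv A B) (hA : Aᵀ = A)
    (hker : ∀ x : Fin n → ℝ, A *ᵥ x = 0 ↔ ∃ c : ℝ, x = fun _ => c) :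
    A * B = piMat n ∧ B * A = piMat n := by
  obtain ⟨h1, -, h3, h4⟩ := hmp
  have hA1 : A *ᵥ (fun _ => 1) = 0 := (hker _).2 ⟨1, rfl⟩
  refine ⟨eq_piMat hn (fun x => (hker x).1) h3 ?_ ?_, eq_piMat hn (fun x => (hker x).1) h4 ?_ ?_⟩
  · rw [← transpose_inj, transpose_mul, h3, hA, h1]
  · rw [← h3, transpose_mul, hA, ← mulVec_mulVec, hA1, mulVec_zero]
  · rw [← mul_assoc, h1]
  · rw [← mulVec_mulVec, hA1, mulVec_zero]

theorem le_chi2 {n : ℕ} {E : Finset (Fin n × Fin n)} (B : Matrix (Fin n) (Fin n) ℝ)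
    {p : Fin n × Fin n} (hp : p ∈ E) :
    gVec n p.1 p.2 ⬝ᵥ (B *ᵥ gVec n p.1 p.2) ≤ 2 * chi2 n E B := by
  have hfin : {r : ℝ | ∃ p ∈ E, r = gVec n p.1 p.2 ⬝ᵥ (B *ᵥ gVec n p.1 p.2)}.Finite := by
    refine (E.finite_toSet.image fun p => gVec n p.1 p.2 ⬝ᵥ (B *ᵥ gVec n p.1 p.2)).subset ?_
    rintro r ⟨p, hp, rfl⟩
    exact ⟨p, hp, rfl⟩
  have := le_csSup hfin.bddAbove ⟨p, hp, rfl⟩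
  rw [chi2]
  linarith

theorem dotProduct_mulVec_sub_smul {n : ℕ} (B : Matrix (Fin n) (Fin n) ℝ) (a v : Fin n → ℝ)
    (t : ℝ) :
    (a - t • v) ⬝ᵥ (B *ᵥ (a - t • v)) - a ⬝ᵥ (B *ᵥ a) =
      -t * (a ⬝ᵥ (B *ᵥ v) + v ⬝ᵥ (B *ᵥ a)) + t ^ 2 * (v ⬝ᵥ (B *ᵥ v)) := by
  simp only [mulVec_sub, mulVec_smul, sub_dotProduct, dotProduct_sub, smul_dotProduct,
    dotProduct_smul, smul_eq_mul]
  ring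

theorem stmt11 (n : ℕ) (hn : 2 ≤ n) (E : Finset (Fin n × Fin n))
    (hE : ∀ p ∈ E, p.1 ≠ p.2) (lam : Fin n × Fin n → ℝ)
    (hlam : ∀ p ∈ E, 0 ≤ lam p) (Λp : Matrix (Fin n) (Fin n) ℝ)
    (hker : ∀ x : Fin n → ℝ, gMat n E lam *ᵥ x = 0 ↔ ∃ c : ℝ, x = fun _ => c)
    (hmp : IsMPInv (gMat n E lam) Λp)
    (βt : ℝ) (zt zs y z ys : Fin n → ℝ)
    (hspan : ∃ c : ℝ, ys + zs = fun _ => c) :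
    ∑ p ∈ E, lam p *
        ((zt - βt • (gP n p.1 p.2 *ᵥ (y + z)) - zs) ⬝ᵥ
            (Λp *ᵥ (zt - βt • (gP n p.1 p.2 *ᵥ (y + z)) - zs)) -
          (zt - zs) ⬝ᵥ (Λp *ᵥ (zt - zs))) ≤
      -(2 * βt) * ((zt - zs) ⬝ᵥ (piMat n *ᵥ (y + z))) +
        chi2 n E Λp * βt ^ 2 *
          ∑ p ∈ E, lam p * ((gP n p.1 p.2 *ᵥ (y + z)) ⬝ᵥ (gP n p.1 p.2 *ᵥ (y + z))) := by
  set w := y + z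
  set a := zt - zs with ha
  obtain ⟨hAB, hBA⟩ := hmp.mul_eq_piMat (by omega) (gMat_transpose n E lam) hker
  have hright : ∑ p ∈ E, lam p * (a ⬝ᵥ (Λp *ᵥ (gP n p.1 p.2 *ᵥ w))) = a ⬝ᵥ (piMat n *ᵥ w) := by
    rw [← hBA, ← mulVec_mulVec, gMat_mulVec, mulVec_sum, dotProduct_sum]
    simp [mulVec_smul]
  have hleft : ∑ p ∈ E, lam p * ((gP n p.1 p.2 *ᵥ w) ⬝ᵥ (Λp *ᵥ a)) = a ⬝ᵥ (piMat n *ᵥ w) := by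
    have hsymm : (piMat n)ᵀ = piMat n := by rw [← hAB, hmp.2.2.1]
    have : a ⬝ᵥ (piMat n *ᵥ w) = (gMat n E lam *ᵥ w) ⬝ᵥ (Λp *ᵥ a) := by
      rw [dotProduct_mulVec, ← mulVec_transpose, hsymm, ← hAB, ← mulVec_mulVec, dotProduct_comm,
        dotProduct_mulVec, ← mulVec_transpose, gMat_transpose]
    rw [this, gMat_mulVec, sum_dotProduct]
    simp
  have hquad : ∀ p ∈ E, (gP n p.1 p.2 *ᵥ w) ⬝ᵥ (Λp *ᵥ (gP n p.1 p.2 *ᵥ w)) ≤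
      chi2 n E Λp * ((gP n p.1 p.2 *ᵥ w) ⬝ᵥ (gP n p.1 p.2 *ᵥ w)) := by
    intro p hp
    simp only [gP_mulVec, mulVec_smul, smul_dotProduct, dotProduct_smul, smul_eq_mul,
      gVec_dotProduct_self (hE p hp)]
    nlinarith [mul_le_mul_of_nonneg_left (le_chi2 Λp hp) (mul_self_nonneg (gVec n p.1 p.2 ⬝ᵥ w))]
  calc _ ≤ ∑ p ∈ E, (-βt * (lam p * (a ⬝ᵥ (Λp *ᵥ (gP n p.1 p.2 *ᵥ w)))) +
          -βt * (lam p * ((gP n p.1 p.2 *ᵥ w) ⬝ᵥ (Λp *ᵥ a))) +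
          chi2 n E Λp * βt ^ 2 * (lam p * ((gP n p.1 p.2 *ᵥ w) ⬝ᵥ (gP n p.1 p.2 *ᵥ w)))) := by
        refine Finset.sum_le_sum fun p hp => ?_
        rw [sub_right_comm, ← ha, dotProduct_mulVec_sub_smul]
        have := mul_le_mul_of_nonneg_left (hquad p hp) (mul_nonneg (hlam p hp) (sq_nonneg βt))
        linarith
    _ = _ := by
        rw [Finset.sum_add_distrib, Finset.sum_add_distrib, ← Finset.mul_sum, ← Finset.mul_sum,
          ← Finset.mul_sum, hright, hleft]
        ring
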